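/- arXiv:2605.00523 — 5 statements merged into one kernel-verified Lean document; each statement's English description precedes it below -/
import Mathlib

section
/- Semantic Disjunction Property: for all formulae φ, ψ of L_ICK, if φ ∨ ψ is valid over one of the classes of all epistemic frames, of reflexive frames, or of S4 frames, then φ is valid or ψ is valid over that same class of frames. -/
namespace ICK

/-- Formulae of the language `L_ICK` over a type of agents and natural-number atoms. -/
inductive Formula (Agent : Type) : Type
  | bot : Formula Agent
  | atom : ℕ → Formula Agent
  | and : Formula Agent → Formula Agent → Formula Agent
  | or : Formula Agent → Formula Agent → Formula Agent
  | imp : Formula Agent → Formula Agent → Formula Agent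
  | know : Agent → Formula Agent → Formula Agent
  | ck : Formula Agent → Formula Agent

namespace Formula

variable {Agent : Type}

/-- `¬φ := φ → ⊥`. -/
def neg (φ : Formula Agent) : Formula Agent := φ.imp Formula.bot

/-- `⊤ := ⊥ → ⊥`. -/
def top : Formula Agent := Formula.imp Formula.bot Formula.bot

/-- `φ ↔ ψ := (φ → ψ) ∧ (ψ → φ)`. -/
def biimp (φ ψ : Formula Agent) : Formula Agent := (φ.imp ψ).and (ψ.imp φ)

end Formula

/-- The formula `E φ = ⋀_{a ∈ A} K_a φ` (everybody knows). -/
noncomputable def Efml {Agent : Type} [Fintype Agent] (φ : Formula Agent) : Formula Agent :=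
  (Finset.univ : Finset Agent).toList.foldr (fun a ψ => (Formula.know a φ).and ψ) Formula.top

/-- A birelational epistemic model: a poset `(W, ≤)` with triangle-confluent
modal relations `R a` and a `≤`-monotone valuation. -/
structure Model (Agent W : Type) where
  le : W → W → Prop
  R : Agent → W → W → Prop
  V : W → ℕ → Prop
  le_refl : ∀ w, le w w
  le_trans : ∀ w v u, le w v → le v u → le w u
  le_antisymm : ∀ w v, le w v → le v w → w = v
  tri : ∀ a w v u, le w v → R a v u → R a w u
  mono : ∀ w v, le w v → ∀ n, V w n → V v n

/-- The union `R = ⋃_a R_a`. -/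
def Model.Step {Agent W : Type} (M : Model Agent W) (w v : W) : Prop := ∃ a, M.R a w v

/-- Intuitionistic truth in an epistemic model. -/
def Sat {Agent W : Type} (M : Model Agent W) : Formula Agent → W → Prop
  | .bot, _ => False
  | .atom n, w => M.V w n
  | .and φ ψ, w => Sat M φ w ∧ Sat M ψ w
  | .or φ ψ, w => Sat M φ w ∨ Sat M ψ w
  | .imp φ ψ, w => ∀ v, M.le w v → Sat M φ v → Sat M ψ v
  | .know a φ, w => ∀ v, M.R a w v → Sat M φ v
  | .ck φ, w => ∀ v, Relation.ReflTransGen M.Step w v → Sat M φ v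

def Model.IsRefl {Agent W : Type} (M : Model Agent W) : Prop := ∀ a w, M.R a w w

def Model.IsTrans {Agent W : Type} (M : Model Agent W) : Prop :=
  ∀ a w v u, M.R a w v → M.R a v u → M.R a w u

def Model.IsSymm {Agent W : Type} (M : Model Agent W) : Prop :=
  ∀ a w v, M.R a w v → M.R a v w

def Model.IsS4 {Agent W : Type} (M : Model Agent W) : Prop := M.IsRefl ∧ M.IsTrans

def Model.IsS5 {Agent W : Type} (M : Model Agent W) : Prop := M.IsS4 ∧ M.IsSymm

/-- Validity over the class of all epistemic frames. -/
def ValidAll (Agent : Type) (φ : Formula Agent) : Prop :=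
  ∀ (W : Type) (M : Model Agent W) (w : W), Sat M φ w

/-- Validity over the class of reflexive epistemic frames. -/
def ValidRefl (Agent : Type) (φ : Formula Agent) : Prop :=
  ∀ (W : Type) (M : Model Agent W), M.IsRefl → ∀ w : W, Sat M φ w

/-- Validity over the class of S4 epistemic frames. -/
def ValidS4 (Agent : Type) (φ : Formula Agent) : Prop :=
  ∀ (W : Type) (M : Model Agent W), M.IsS4 → ∀ w : W, Sat M φ w

/-- Validity over the class of S5 epistemic frames. -/
def ValidS5 (Agent : Type) (φ : Formula Agent) : Prop :=
  ∀ (W : Type) (M : Model Agent W), M.IsS5 → ∀ w : W, Sat M φ w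

/-- Truth is persistent along the intuitionistic order. -/
theorem Sat.persistent {Agent W : Type} (M : Model Agent W) (φ : Formula Agent) :
    ∀ {w v : W}, M.le w v → Sat M φ w → Sat M φ v := by
  induction φ with
  | bot => exact fun _ h => h
  | atom n => exact fun h hw => M.mono _ _ h n hw
  | and φ ψ ihφ ihψ => exact fun h hw => ⟨ihφ h hw.1, ihψ h hw.2⟩
  | or φ ψ ihφ ihψ => exact fun h hw => hw.imp (ihφ h) (ihψ h)
  | imp φ ψ _ _ => exact fun h hw u hu => hw u (M.le_trans _ _ _ h hu)
  | know a φ _ => exact fun h hw u hu => hw u (M.tri _ _ _ _ h hu)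
  | ck φ ih =>
    intro w v h hw u hu
    rcases hu.cases_head with rfl | ⟨x, ⟨a, hx⟩, hxu⟩
    · exact ih h (hw _ .refl)
    · exact hw u (.head ⟨a, M.tri _ _ _ _ h hx⟩ hxu)

/-- A bounded morphism between epistemic models. -/
structure IsBoundedMorphism {Agent W W' : Type} (M : Model Agent W) (M' : Model Agent W')
    (f : W → W') : Prop where
  val_iff : ∀ w n, M'.V (f w) n ↔ M.V w n
  le_forth : ∀ w v, M.le w v → M'.le (f w) (f v)
  le_back : ∀ w v', M'.le (f w) v' → ∃ v, M.le w v ∧ f v = v'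
  rel_forth : ∀ a w v, M.R a w v → M'.R a (f w) (f v)
  rel_back : ∀ a w v', M'.R a (f w) v' → ∃ v, M.R a w v ∧ f v = v'

namespace IsBoundedMorphism

variable {Agent W W' : Type} {M : Model Agent W} {M' : Model Agent W'} {f : W → W'}

theorem reflTransGen_forth (hf : IsBoundedMorphism M M' f) {w v : W}
    (h : Relation.ReflTransGen M.Step w v) : Relation.ReflTransGen M'.Step (f w) (f v) :=
  h.lift f fun _ _ ⟨a, ha⟩ => ⟨a, hf.rel_forth a _ _ ha⟩

theorem reflTransGen_back (hf : IsBoundedMorphism M M' f) {w : W} {v' : W'}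
    (h : Relation.ReflTransGen M'.Step (f w) v') :
    ∃ v, Relation.ReflTransGen M.Step w v ∧ f v = v' := by
  induction h with
  | refl => exact ⟨w, .refl, rfl⟩
  | tail _ hs ih =>
    obtain ⟨x, hx, rfl⟩ := ih
    obtain ⟨a, ha⟩ := hs
    obtain ⟨y, hy, rfl⟩ := hf.rel_back a _ _ ha
    exact ⟨y, hx.tail ⟨a, hy⟩, rfl⟩

/-- Bounded morphisms preserve and reflect truth. -/
theorem sat_iff (hf : IsBoundedMorphism M M' f) (φ : Formula Agent) :
    ∀ w, Sat M' φ (f w) ↔ Sat M φ w := by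
  induction φ with
  | bot => exact fun _ => Iff.rfl
  | atom n => exact fun w => hf.val_iff w n
  | and φ ψ ihφ ihψ => exact fun w => and_congr (ihφ w) (ihψ w)
  | or φ ψ ihφ ihψ => exact fun w => or_congr (ihφ w) (ihψ w)
  | imp φ ψ ihφ ihψ =>
    refine fun w => ⟨fun h v hv hφ => ?_, fun h v' hv hφ => ?_⟩
    · exact (ihψ v).1 (h (f v) (hf.le_forth w v hv) ((ihφ v).2 hφ))
    · obtain ⟨v, hwv, rfl⟩ := hf.le_back w v' hv
      exact (ihψ v).2 (h v hwv ((ihφ v).1 hφ))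
  | know a φ ih =>
    refine fun w => ⟨fun h v hv => (ih v).1 (h (f v) (hf.rel_forth a w v hv)), fun h v' hv => ?_⟩
    obtain ⟨v, hwv, rfl⟩ := hf.rel_back a w v' hv
    exact (ih v).2 (h v hwv)
  | ck φ ih =>
    refine fun w => ⟨fun h v hv => (ih v).1 (h (f v) (hf.reflTransGen_forth hv)), fun h v' hv => ?_⟩
    obtain ⟨v, hwv, rfl⟩ := hf.reflTransGen_back hv
    exact (ih v).2 (h v hwv)

end IsBoundedMorphism

/-- Extend a relation to `Option α` so that `none` is related to everything and is related to
from nothing but itself. -/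
def rootRel {α : Type} (r : α → α → Prop) : Option α → Option α → Prop
  | none, _ => True
  | some _, none => False
  | some x, some y => r x y

/-- The disjoint union of two models with a new root below all worlds, from which every world is
accessible for every agent and at which no atom holds. -/
def Model.glue {Agent W₁ W₂ : Type} (M₁ : Model Agent W₁) (M₂ : Model Agent W₂) :
    Model Agent (Option (W₁ ⊕ W₂)) where
  le := rootRel (Sum.LiftRel M₁.le M₂.le)
  R a := rootRel (Sum.LiftRel (M₁.R a) (M₂.R a))
  V
    | none, _ => False
    | some (.inl w), n => M₁.V w n
    | some (.inr w), n => M₂.V w n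
  le_refl := by
    rintro (_ | w | w)
    · trivial
    · exact .inl (M₁.le_refl w)
    · exact .inr (M₂.le_refl w)
  le_trans := by
    rintro (_ | w) (_ | v) (_ | u) h h' <;> try trivial
    cases h with
    | inl h => cases h' with | inl h' => exact .inl (M₁.le_trans _ _ _ h h')
    | inr h => cases h' with | inr h' => exact .inr (M₂.le_trans _ _ _ h h')
  le_antisymm := by
    rintro (_ | w) (_ | v) h h' <;> try trivial
    cases h with
    | inl h => cases h' with | inl h' => rw [M₁.le_antisymm _ _ h h']
    | inr h => cases h' with | inr h' => rw [M₂.le_antisymm _ _ h h']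
  tri := by
    rintro a (_ | w) (_ | v) (_ | u) h h' <;> try trivial
    cases h with
    | inl h => cases h' with | inl h' => exact .inl (M₁.tri _ _ _ _ h h')
    | inr h => cases h' with | inr h' => exact .inr (M₂.tri _ _ _ _ h h')
  mono := by
    rintro (_ | w) (_ | v) h n hn <;> try trivial
    cases h with
    | inl h => exact M₁.mono _ _ h n hn
    | inr h => exact M₂.mono _ _ h n hn

section Glue

variable {Agent W₁ W₂ : Type} {M₁ : Model Agent W₁} {M₂ : Model Agent W₂}

theorem Model.IsRefl.glue (h₁ : M₁.IsRefl) (h₂ : M₂.IsRefl) : (M₁.glue M₂).IsRefl := by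
  rintro a (_ | w | w)
  · trivial
  · exact .inl (h₁ a w)
  · exact .inr (h₂ a w)

theorem Model.IsTrans.glue (h₁ : M₁.IsTrans) (h₂ : M₂.IsTrans) : (M₁.glue M₂).IsTrans := by
  rintro a (_ | w) (_ | v) (_ | u) h h' <;> try trivial
  cases h with
  | inl h => cases h' with | inl h' => exact .inl (h₁ _ _ _ _ h h')
  | inr h => cases h' with | inr h' => exact .inr (h₂ _ _ _ _ h h')

theorem Model.IsS4.glue (h₁ : M₁.IsS4) (h₂ : M₂.IsS4) : (M₁.glue M₂).IsS4 :=
  ⟨h₁.1.glue h₂.1, h₁.2.glue h₂.2⟩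

variable (M₁ M₂)

theorem isBoundedMorphism_inl :
    IsBoundedMorphism M₁ (M₁.glue M₂) (fun w => some (.inl w)) where
  val_iff _ _ := Iff.rfl
  le_forth _ _ h := Sum.LiftRel.inl h
  le_back := by
    rintro w (_ | v) h
    · exact h.elim
    · cases h with | inl h => exact ⟨_, h, rfl⟩
  rel_forth _ _ _ h := Sum.LiftRel.inl h
  rel_back := by
    rintro a w (_ | v) h
    · exact h.elim
    · cases h with | inl h => exact ⟨_, h, rfl⟩

theorem isBoundedMorphism_inr :
    IsBoundedMorphism M₂ (M₁.glue M₂) (fun w => some (.inr w)) where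
  val_iff _ _ := Iff.rfl
  le_forth _ _ h := Sum.LiftRel.inr h
  le_back := by
    rintro w (_ | v) h
    · exact h.elim
    · cases h with | inr h => exact ⟨_, h, rfl⟩
  rel_forth _ _ _ h := Sum.LiftRel.inr h
  rel_back := by
    rintro a w (_ | v) h
    · exact h.elim
    · cases h with | inr h => exact ⟨_, h, rfl⟩

end Glue

/-- The disjunction property holds for every class of models closed under `Model.glue`. -/
theorem disjunction_property_of_glue {Agent : Type} (P : ∀ W : Type, Model Agent W → Prop)
    (hP : ∀ (W₁ W₂ : Type) (M₁ : Model Agent W₁) (M₂ : Model Agent W₂),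
      P W₁ M₁ → P W₂ M₂ → P _ (M₁.glue M₂))
    {φ ψ : Formula Agent} (h : ∀ W (M : Model Agent W), P W M → ∀ w, Sat M (φ.or ψ) w) :
    (∀ W (M : Model Agent W), P W M → ∀ w, Sat M φ w) ∨
      (∀ W (M : Model Agent W), P W M → ∀ w, Sat M ψ w) := by
  by_contra! hcon
  obtain ⟨⟨W₁, M₁, h₁, w₁, hφ⟩, W₂, M₂, h₂, w₂, hψ⟩ := hcon
  rcases h _ _ (hP _ _ _ _ h₁ h₂) none with hr | hr
  · exact hφ (((isBoundedMorphism_inl M₁ M₂).sat_iff φ w₁).1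
      (Sat.persistent (w := none) _ φ trivial hr))
  · exact hψ (((isBoundedMorphism_inr M₁ M₂).sat_iff ψ w₂).1
      (Sat.persistent (w := none) _ ψ trivial hr))

/-- Semantic Disjunction Property for the classes of all, reflexive and S4 frames. -/
theorem semantic_disjunction_property (Agent : Type) [Fintype Agent] [Nonempty Agent]
    (φ ψ : Formula Agent) :
    (ValidAll Agent (φ.or ψ) → ValidAll Agent φ ∨ ValidAll Agent ψ) ∧
    (ValidRefl Agent (φ.or ψ) → ValidRefl Agent φ ∨ ValidRefl Agent ψ) ∧
    (ValidS4 Agent (φ.or ψ) → ValidS4 Agent φ ∨ ValidS4 Agent ψ) := by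
  refine ⟨fun h => ?_, fun h => ?_, fun h => ?_⟩
  · simpa only [ValidAll, true_imp_iff] using
      disjunction_property_of_glue (fun _ _ => True) (fun _ _ _ _ _ _ => trivial)
        (fun W M _ => h W M)
  · exact disjunction_property_of_glue (fun _ M => M.IsRefl) (fun _ _ _ _ => .glue) h
  · exact disjunction_property_of_glue (fun _ M => M.IsS4) (fun _ _ _ _ => .glue) h

end ICK
end

section
/- For every S5 epistemic model M, every world w, every agent a ∈ A and all formulae φ, ψ of L_ICK: M, w ⊨ K_aφ → ψ if and only if M, w ⊭ K_aφ or M, w ⊨ ψ. -/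
namespace ICK

/-- Truth persists along the intuitionistic order. -/
theorem Sat.mono {Agent W : Type} {M : Model Agent W} {φ : Formula Agent} {w v : W}
    (hwv : M.le w v) (h : Sat M φ w) : Sat M φ v := by
  induction φ generalizing w v with
  | bot => exact h
  | atom n => exact M.mono w v hwv n h
  | and φ ψ ihφ ihψ => exact ⟨ihφ hwv h.1, ihψ hwv h.2⟩
  | or φ ψ ihφ ihψ => exact h.imp (ihφ hwv) (ihψ hwv)
  | imp φ ψ _ _ => exact fun u hvu => h u (M.le_trans w v u hwv hvu)
  | know a φ _ => exact fun u hvu => h u (M.tri a w v u hwv hvu)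
  | ck φ ih =>
    intro u hvu
    rcases hvu.cases_head with rfl | ⟨x, ⟨a, hvx⟩, hxu⟩
    · exact ih hwv (h w .refl)
    · exact h u (.head ⟨a, M.tri a w v x hwv hvx⟩ hxu)

/-- In S5 models, comparable worlds are indistinguishable to every agent. -/
theorem Model.IsS5.rel_of_le {Agent W : Type} {M : Model Agent W} (h5 : M.IsS5) (a : Agent)
    {w v : W} (hwv : M.le w v) : M.R a w v :=
  M.tri a w v v hwv (h5.1.1 a v)

/-- In S5 models, a boxed formula true at a world is true at every smaller world. -/
theorem Model.IsS5.sat_know_of_le {Agent W : Type} {M : Model Agent W} (h5 : M.IsS5)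
    {a : Agent} {φ : Formula Agent} {w v : W} (hwv : M.le w v)
    (h : Sat M (Formula.know a φ) v) : Sat M (Formula.know a φ) w :=
  fun u hwu => h u (h5.1.2 a v w u (h5.2 a w v (h5.rel_of_le a hwv)) hwu)

/-- Over S5 models, implications with boxed antecedent are evaluated classically. -/
theorem s5_boxed_implication_classical (Agent : Type) [Fintype Agent] [Nonempty Agent]
    (W : Type) (M : Model Agent W) (h5 : M.IsS5) (w : W) (a : Agent)
    (φ ψ : Formula Agent) :
    Sat M ((Formula.know a φ).imp ψ) w ↔
      (¬ Sat M (Formula.know a φ) w ∨ Sat M ψ w) := by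
  constructor
  · intro h
    by_cases hK : Sat M (Formula.know a φ) w
    · exact .inr (h w (M.le_refl w) hK)
    · exact .inl hK
  · rintro (hK | hψ) v hwv hv
    · exact absurd (h5.sat_know_of_le hwv hv) hK
    · exact hψ.mono hwv

end ICK
end

section
/- Lindenbaum Lemma: let P ∈ {ICK, ICKT, ICKS4, ICKS5}, let Σ be a finite closed set of formulae, and let Γ ⊆ Σ with Γ ⊬_P φ. Then there exists a Σ-prime theory Δ relative to P with Γ ⊆ Δ and Δ ⊬_P φ. If moreover P = ICKS5 and Σ is negation closed, then Δ can be chosen K-maximally consistent. -/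
namespace ICK

/-- Purely propositional formulae (for intuitionistic tautologies). -/
inductive PropForm : Type
  | bot : PropForm
  | atom : ℕ → PropForm
  | and : PropForm → PropForm → PropForm
  | or : PropForm → PropForm → PropForm
  | imp : PropForm → PropForm → PropForm

/-- Kripke models for intuitionistic propositional logic. -/
structure IModel (W : Type) where
  le : W → W → Prop
  le_refl : ∀ w, le w w
  le_trans : ∀ w v u, le w v → le v u → le w u
  V : W → ℕ → Prop
  mono : ∀ w v, le w v → ∀ n, V w n → V v n

def ISat {W : Type} (M : IModel W) : PropForm → W → Prop
  | .bot, _ => False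
  | .atom n, w => M.V w n
  | .and p q, w => ISat M p w ∧ ISat M q w
  | .or p q, w => ISat M p w ∨ ISat M q w
  | .imp p q, w => ∀ v, M.le w v → ISat M p v → ISat M q v

/-- IPC validity of a propositional formula. -/
def IPCValid (p : PropForm) : Prop := ∀ (W : Type) (M : IModel W) (w : W), ISat M p w

/-- Substitution of `L_ICK`-formulae for atoms in a propositional formula. -/
def PropForm.subst {Agent : Type} (σ : ℕ → Formula Agent) : PropForm → Formula Agent
  | .bot => Formula.bot
  | .atom n => σ n
  | .and p q => (p.subst σ).and (q.subst σ)
  | .or p q => (p.subst σ).or (q.subst σ)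
  | .imp p q => (p.subst σ).imp (q.subst σ)

/-- The four Hilbert systems. -/
inductive Sys : Type
  | ick : Sys
  | ickt : Sys
  | icks4 : Sys
  | icks5 : Sys

/-- Systems containing the factivity axiom `T`. -/
def Sys.hasT : Sys → Prop
  | Sys.ick => False
  | _ => True

/-- Systems containing the positive introspection axiom `S4`. -/
def Sys.hasS4 : Sys → Prop
  | Sys.icks4 => True
  | Sys.icks5 => True
  | _ => False

/-- Systems containing the classicality and negative introspection axioms. -/
def Sys.hasS5 : Sys → Prop
  | Sys.icks5 => True
  | _ => False

/-- Axioms of the Hilbert systems. -/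
inductive Ax (Agent : Type) [Fintype Agent] : Sys → Formula Agent → Prop
  | taut (P : Sys) (p : PropForm) (σ : ℕ → Formula Agent) :
      IPCValid p → Ax Agent P (p.subst σ)
  | axK (P : Sys) (a : Agent) (φ ψ : Formula Agent) :
      Ax Agent P ((Formula.know a (φ.imp ψ)).imp ((Formula.know a φ).imp (Formula.know a ψ)))
  | fix (P : Sys) (φ : Formula Agent) :
      Ax Agent P ((Formula.ck φ).biimp (φ.and (Efml (Formula.ck φ))))
  | axT (P : Sys) (a : Agent) (φ : Formula Agent) :
      P.hasT → Ax Agent P ((Formula.know a φ).imp φ)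
  | axS4 (P : Sys) (a : Agent) (φ : Formula Agent) :
      P.hasS4 → Ax Agent P ((Formula.know a φ).imp (Formula.know a (Formula.know a φ)))
  | axKc (P : Sys) (a : Agent) (φ ψ : Formula Agent) :
      P.hasS5 → Ax Agent P (((Formula.know a φ).imp ψ).imp (((Formula.know a φ).neg).or ψ))
  | axS5 (P : Sys) (a : Agent) (φ : Formula Agent) :
      P.hasS5 → Ax Agent P (((Formula.know a φ).neg).imp (Formula.know a ((Formula.know a φ).neg)))

/-- Theoremhood (derivability without assumptions) in system `P`. -/
inductive Thm (Agent : Type) [Fintype Agent] (P : Sys) : Formula Agent → Prop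
  | ax {φ : Formula Agent} : Ax Agent P φ → Thm Agent P φ
  | mp {φ ψ : Formula Agent} : Thm Agent P (φ.imp ψ) → Thm Agent P φ → Thm Agent P ψ
  | nec {φ : Formula Agent} (a : Agent) : Thm Agent P φ → Thm Agent P (Formula.know a φ)
  | mon {φ ψ : Formula Agent} :
      Thm Agent P (φ.imp ψ) → Thm Agent P ((Formula.ck φ).imp (Formula.ck ψ))
  | ind {φ : Formula Agent} :
      Thm Agent P (φ.imp (Efml φ)) → Thm Agent P (φ.imp (Formula.ck φ))

/-- Derivability of `φ` from assumptions `Γ` in system `P`: the rules of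
necessitation, monotonicity and induction may only be applied in
assumption-free subderivations. -/
inductive Deriv (Agent : Type) [Fintype Agent] (P : Sys) (Γ : Set (Formula Agent)) :
    Formula Agent → Prop
  | assum {φ : Formula Agent} : φ ∈ Γ → Deriv Agent P Γ φ
  | thm {φ : Formula Agent} : Thm Agent P φ → Deriv Agent P Γ φ
  | mp {φ ψ : Formula Agent} :
      Deriv Agent P Γ (φ.imp ψ) → Deriv Agent P Γ φ → Deriv Agent P Γ ψ

/-- A set of formulae is closed (under subformulae and `C`-unfoldings). -/
def Closed {Agent : Type} (S : Set (Formula Agent)) : Prop :=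
  (∀ φ ψ : Formula Agent, φ.and ψ ∈ S → φ ∈ S ∧ ψ ∈ S) ∧
  (∀ φ ψ : Formula Agent, φ.or ψ ∈ S → φ ∈ S ∧ ψ ∈ S) ∧
  (∀ φ ψ : Formula Agent, φ.imp ψ ∈ S → φ ∈ S ∧ ψ ∈ S) ∧
  (∀ (a : Agent) (φ : Formula Agent), Formula.know a φ ∈ S → φ ∈ S) ∧
  (∀ φ : Formula Agent, Formula.ck φ ∈ S →
    φ ∈ S ∧ ∀ a : Agent, Formula.know a (Formula.ck φ) ∈ S)

/-- A set of formulae is negation closed. -/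
def NegClosed {Agent : Type} (S : Set (Formula Agent)) : Prop :=
  Closed S ∧
  ∀ (a : Agent) (φ : Formula Agent), Formula.know a φ ∈ S → (Formula.know a φ).neg ∈ S

/-- `Γ` is a `S`-prime theory relative to `P`. -/
def PrimeTheory (Agent : Type) [Fintype Agent] (P : Sys) (S Γ : Set (Formula Agent)) : Prop :=
  Γ ⊆ S ∧
  ¬ Deriv Agent P Γ Formula.bot ∧
  (∀ φ : Formula Agent, Deriv Agent P Γ φ → φ ∈ S → φ ∈ Γ) ∧
  (∀ φ ψ : Formula Agent, φ.or ψ ∈ Γ → φ ∈ Γ ∨ ψ ∈ Γ)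

/-- `Γ` is K-maximally consistent (relative to `S`). -/
def KMax {Agent : Type} (S Γ : Set (Formula Agent)) : Prop :=
  ∀ (a : Agent) (φ : Formula Agent), Formula.know a φ ∈ S →
    (Formula.know a φ ∈ Γ ↔ (Formula.know a φ).neg ∉ Γ)

namespace Deriv

variable {Agent : Type} [Fintype Agent] {P : Sys} {Γ : Set (Formula Agent)}
  {φ ψ χ : Formula Agent}

/-- Substitution instances of valid propositional formulae are derivable. -/
theorem of_valid (p : PropForm) (σ : ℕ → Formula Agent) (hp : IPCValid p) :
    Deriv Agent P Γ (p.subst σ) :=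
  thm (.ax (.taut P p σ hp))

/-- The substitution sending the first three atoms to `φ`, `ψ` and `χ`. -/
def substThree (φ ψ χ : Formula Agent) : ℕ → Formula Agent
  | 0 => φ
  | 1 => ψ
  | _ => χ

theorem imp_self : Deriv Agent P Γ (φ.imp φ) :=
  of_valid (.imp (.atom 0) (.atom 0)) (substThree φ φ φ) fun _ _ _ _ _ h => h

theorem imp_intro_axiom : Deriv Agent P Γ (φ.imp (ψ.imp φ)) :=
  of_valid (.imp (.atom 0) (.imp (.atom 1) (.atom 0))) (substThree φ ψ φ)
    fun _ M _ _ _ h _ hvu _ => M.mono _ _ hvu _ h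

theorem imp_distrib_axiom :
    Deriv Agent P Γ ((φ.imp (ψ.imp χ)).imp ((φ.imp ψ).imp (φ.imp χ))) :=
  of_valid
    (.imp (.imp (.atom 0) (.imp (.atom 1) (.atom 2)))
      (.imp (.imp (.atom 0) (.atom 1)) (.imp (.atom 0) (.atom 2))))
    (substThree φ ψ χ)
    fun _ M _ _ _ h _ hvu hu x hux hx =>
      h x (M.le_trans _ _ _ hvu hux) hx x (M.le_refl x) (hu x hux hx)

theorem bot_imp : Deriv Agent P Γ (Formula.bot.imp φ) :=
  of_valid (.imp .bot (.atom 0)) (substThree φ φ φ) fun _ _ _ _ _ h => h.elim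

theorem or_elim_axiom :
    Deriv Agent P Γ ((φ.imp χ).imp ((ψ.imp χ).imp ((φ.or ψ).imp χ))) :=
  of_valid
    (.imp (.imp (.atom 0) (.atom 2))
      (.imp (.imp (.atom 1) (.atom 2)) (.imp (.or (.atom 0) (.atom 1)) (.atom 2))))
    (substThree φ ψ χ)
    fun _ M _ _ _ h _ hvu hu x hux hx =>
      hx.elim (h x (M.le_trans _ _ _ hvu hux)) (hu x hux)

/-- The deduction theorem. -/
theorem imp_of_insert (h : Deriv Agent P (insert φ Γ) ψ) : Deriv Agent P Γ (φ.imp ψ) := by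
  induction h with
  | assum hmem =>
    rcases hmem with rfl | hmem
    · exact imp_self
    · exact imp_intro_axiom.mp (assum hmem)
  | thm ht => exact imp_intro_axiom.mp (thm ht)
  | mp _ _ ih₁ ih₂ => exact (imp_distrib_axiom.mp ih₁).mp ih₂

theorem cut (h : Deriv Agent P Γ φ) (h' : Deriv Agent P (insert φ Γ) ψ) : Deriv Agent P Γ ψ :=
  h'.imp_of_insert.mp h

theorem or_elim (h : Deriv Agent P Γ (φ.or ψ)) (hφ : Deriv Agent P (insert φ Γ) χ)
    (hψ : Deriv Agent P (insert ψ Γ) χ) : Deriv Agent P Γ χ :=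
  ((or_elim_axiom.mp hφ.imp_of_insert).mp hψ.imp_of_insert).mp h

/-- Excluded middle for knowledge formulae in systems containing the classicality axiom. -/
theorem neg_know_or_know (hP : P.hasS5) (a : Agent) (φ : Formula Agent) :
    Deriv Agent P Γ ((Formula.know a φ).neg.or (Formula.know a φ)) :=
  (thm (.ax (.axKc P a φ (Formula.know a φ) hP))).mp imp_self

end Deriv

/-- Lindenbaum Lemma. -/
theorem lindenbaum (Agent : Type) [Fintype Agent] [Nonempty Agent] (P : Sys)
    (S : Set (Formula Agent)) (hfin : S.Finite) (hcl : Closed S)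
    (Γ : Set (Formula Agent)) (hsub : Γ ⊆ S) (φ : Formula Agent)
    (h : ¬ Deriv Agent P Γ φ) :
    ∃ Δ : Set (Formula Agent), PrimeTheory Agent P S Δ ∧ Γ ⊆ Δ ∧ ¬ Deriv Agent P Δ φ ∧
      (P = Sys.icks5 → NegClosed S → KMax S Δ) := by
  have hfinite : {Δ | Δ ⊆ S ∧ ¬ Deriv Agent P Δ φ}.Finite :=
    hfin.finite_subsets.subset fun _ hΔ => hΔ.1
  obtain ⟨Δ, hΓΔ, hmax⟩ := hfinite.exists_le_maximal (a := Γ) ⟨hsub, h⟩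
  obtain ⟨hΔS, hΔφ⟩ := hmax.prop
  have mem_of_not_deriv : ∀ ψ ∈ S, ¬ Deriv Agent P (insert ψ Δ) φ → ψ ∈ Δ := fun ψ hψ hd =>
    hmax.le_of_ge ⟨Set.insert_subset hψ hΔS, hd⟩ (Set.subset_insert ψ Δ) (Set.mem_insert ψ Δ)
  have mem_or_mem : ∀ ψ χ, ψ ∈ S → χ ∈ S → Deriv Agent P Δ (ψ.or χ) → ψ ∈ Δ ∨ χ ∈ Δ := by
    intro ψ χ hψ hχ hd
    by_contra! hn
    exact hΔφ (hd.or_elim (not_not.1 (mt (mem_of_not_deriv ψ hψ) hn.1))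
      (not_not.1 (mt (mem_of_not_deriv χ hχ) hn.2)))
  have consistent : ¬ Deriv Agent P Δ Formula.bot := fun hb => hΔφ (Deriv.bot_imp.mp hb)
  refine ⟨Δ, ⟨hΔS, consistent, fun ψ hd hψ => mem_of_not_deriv ψ hψ fun h' => hΔφ (hd.cut h'),
    fun ψ χ hor => ?_⟩, hΓΔ, hΔφ, ?_⟩
  · obtain ⟨hψ, hχ⟩ := hcl.2.1 ψ χ (hΔS hor)
    exact mem_or_mem ψ χ hψ hχ (.assum hor)
  · rintro rfl hneg a ψ hψ
    exact ⟨fun hk hn => consistent (.mp (.assum hn) (.assum hk)),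
      (mem_or_mem _ _ (hneg.2 a ψ hψ) hψ
        (Deriv.neg_know_or_know (P := .icks5) trivial a ψ)).resolve_left⟩

end ICK
end

section
/- Let Σ be a nonempty finite closed set of formulae. Then: the canonical model M^{(Σ,ICK)} is a finite epistemic model; M^{(Σ,ICKT)} is a finite reflexive epistemic model; M^{(Σ,ICKS4)} is a finite S4 epistemic model; and if Σ is negation closed, M^{(Σ,ICKS5)} is a finite S5 epistemic model. -/
namespace ICK

/-- `K_a^{-1} Γ = {φ | K_a φ ∈ Γ}`. -/
def Kinv {Agent : Type} (a : Agent) (Γ : Set (Formula Agent)) : Set (Formula Agent) :=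
  {φ | Formula.know a φ ∈ Γ}

/-- `K_a Γ = {K_a φ | φ ∈ Γ}`. -/
def Kimg {Agent : Type} (a : Agent) (Γ : Set (Formula Agent)) : Set (Formula Agent) :=
  Formula.know a '' Γ

/-- The canonical modal accessibility relation for each system. -/
def canonRel {Agent : Type} (P : Sys) (a : Agent) (Γ Δ : Set (Formula Agent)) : Prop :=
  match P with
  | Sys.ick => Kinv a Γ ⊆ Δ
  | Sys.ickt => Kinv a Γ ⊆ Δ
  | Sys.icks4 => Kimg a (Kinv a Γ) ⊆ Δ
  | Sys.icks5 => Kimg a (Kinv a Γ) = Kimg a (Kinv a Δ)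

/-- Worlds of the canonical model: `S`-prime theories relative to `P`,
which are moreover K-maximally consistent if `P = ICKS5`. -/
def IsCanonWorld (Agent : Type) [Fintype Agent] (P : Sys) (S Γ : Set (Formula Agent)) : Prop :=
  PrimeTheory Agent P S Γ ∧ (P = Sys.icks5 → KMax S Γ)

def CanonWorld (Agent : Type) [Fintype Agent] (P : Sys) (S : Set (Formula Agent)) : Type :=
  {Γ : Set (Formula Agent) // IsCanonWorld Agent P S Γ}

/-- Truth at the single world of the one-point reflexive model in which every atom holds. -/
def Formula.Holds {Agent : Type} : Formula Agent → Prop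
  | .bot => False
  | .atom _ => True
  | .and φ ψ => φ.Holds ∧ ψ.Holds
  | .or φ ψ => φ.Holds ∨ ψ.Holds
  | .imp φ ψ => φ.Holds → ψ.Holds
  | .know _ φ => φ.Holds
  | .ck φ => φ.Holds

theorem Formula.Holds.efml {Agent : Type} [Fintype Agent] {φ : Formula Agent} (h : φ.Holds) :
    (Efml φ).Holds := by
  unfold Efml
  induction (Finset.univ : Finset Agent).toList with
  | nil => exact id
  | cons a l ih => exact ⟨h, ih⟩

theorem IPCValid.holds_subst {Agent : Type} {p : PropForm} (hp : IPCValid p)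
    (σ : ℕ → Formula Agent) : (p.subst σ).Holds := by
  let M : IModel Unit :=
    { le := fun _ _ => True
      le_refl := fun _ => trivial
      le_trans := fun _ _ _ _ _ => trivial
      V := fun _ n => (σ n).Holds
      mono := fun _ _ _ _ h => h }
  have key : ∀ q : PropForm, ISat M q () ↔ (q.subst σ).Holds := by
    intro q
    induction q with
    | bot => exact Iff.rfl
    | atom n => exact Iff.rfl
    | and q r ihq ihr => exact and_congr ihq ihr
    | or q r ihq ihr => exact or_congr ihq ihr
    | imp q r ihq ihr =>
      exact ⟨fun h hq => ihr.1 (h () trivial (ihq.2 hq)),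
        fun h _ _ hq => ihr.2 (h (ihq.1 hq))⟩
  exact (key p).1 (hp Unit M ())

theorem Ax.holds {Agent : Type} [Fintype Agent] {P : Sys} {φ : Formula Agent}
    (h : Ax Agent P φ) : φ.Holds := by
  cases h with
  | taut p σ hp => exact hp.holds_subst σ
  | axK a φ ψ => exact id
  | fix φ =>
    exact ⟨fun h => ⟨h, Formula.Holds.efml (φ := φ.ck) h⟩, fun h => h.1⟩
  | axT a φ _ => exact id
  | axS4 a φ _ => exact id
  | axKc a φ ψ _ => exact fun h => not_or_of_imp h
  | axS5 a φ _ => exact id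

theorem Thm.holds {Agent : Type} [Fintype Agent] {P : Sys} {φ : Formula Agent}
    (h : Thm Agent P φ) : φ.Holds := by
  induction h with
  | ax h => exact h.holds
  | mp _ _ ih₁ ih₂ => exact ih₁ ih₂
  | nec a _ ih => exact ih
  | mon _ ih => exact ih
  | ind _ _ => exact id

theorem Deriv.holds {Agent : Type} [Fintype Agent] {P : Sys} {Γ : Set (Formula Agent)}
    (hΓ : ∀ φ ∈ Γ, φ.Holds) {φ : Formula Agent} (h : Deriv Agent P Γ φ) : φ.Holds := by
  induction h with
  | assum h => exact hΓ _ h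
  | thm h => exact h.holds
  | mp _ _ ih₁ ih₂ => exact ih₁ ih₂

/-- The formulae of `S` true in the one-point model form a world of every canonical model. -/
theorem isCanonWorld_holds {Agent : Type} [Fintype Agent] (P : Sys) {S : Set (Formula Agent)}
    (hcl : Closed S) (hneg : P = Sys.icks5 → NegClosed S) :
    IsCanonWorld Agent P S {φ | φ ∈ S ∧ φ.Holds} := by
  refine ⟨⟨fun φ h => h.1, fun h => h.holds fun φ hφ => hφ.2,
    fun φ h hS => ⟨hS, h.holds fun ψ hψ => hψ.2⟩, ?_⟩, ?_⟩
  · rintro φ ψ ⟨hS, h | h⟩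
    · exact Or.inl ⟨(hcl.2.1 φ ψ hS).1, h⟩
    · exact Or.inr ⟨(hcl.2.1 φ ψ hS).2, h⟩
  · intro hP a φ hS
    exact ⟨fun h hn => hn.2 h.2,
      fun h => ⟨hS, by_contra fun hn => h ⟨(hneg hP).2 a φ hS, hn⟩⟩⟩

theorem PrimeTheory.neg_notMem {Agent : Type} [Fintype Agent] {P : Sys}
    {S Γ : Set (Formula Agent)} (h : PrimeTheory Agent P S Γ) {φ : Formula Agent}
    (hφ : φ ∈ Γ) : φ.neg ∉ Γ :=
  fun hn => h.2.1 (.mp (.assum hn) (.assum hφ))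

theorem PrimeTheory.kinv_subset {Agent : Type} [Fintype Agent] {P : Sys} (hT : P.hasT)
    {S Γ : Set (Formula Agent)} (hcl : Closed S) (h : PrimeTheory Agent P S Γ) (a : Agent) :
    Kinv a Γ ⊆ Γ := fun φ hφ =>
  h.2.2.1 φ (.mp (.thm (.ax (.axT P a φ hT))) (.assum hφ)) (hcl.2.2.2.1 a φ (h.1 hφ))

theorem Kinv_mono {Agent : Type} (a : Agent) {Γ Δ : Set (Formula Agent)} (h : Γ ⊆ Δ) :
    Kinv a Γ ⊆ Kinv a Δ := fun _ hφ => h hφ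

theorem Kimg_Kinv_subset {Agent : Type} (a : Agent) (Γ : Set (Formula Agent)) :
    Kimg a (Kinv a Γ) ⊆ Γ := by
  rintro _ ⟨φ, hφ, rfl⟩
  exact hφ

theorem Kimg_Kinv_subset_trans {Agent : Type} {a : Agent} {Γ Δ Θ : Set (Formula Agent)}
    (h₁ : Kimg a (Kinv a Γ) ⊆ Δ) (h₂ : Kimg a (Kinv a Δ) ⊆ Θ) : Kimg a (Kinv a Γ) ⊆ Θ := by
  rintro _ ⟨φ, hφ, rfl⟩
  exact h₂ ⟨φ, h₁ ⟨φ, hφ, rfl⟩, rfl⟩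

/-- Inclusion-comparable K-maximally consistent prime theories contain the same `K_a φ`. -/
theorem KMax.kinv_eq_of_subset {Agent : Type} [Fintype Agent] {P : Sys}
    {S Γ Δ : Set (Formula Agent)} (hΓ : KMax S Γ) (hΔ : PrimeTheory Agent P S Δ) (h : Γ ⊆ Δ)
    (a : Agent) : Kinv a Γ = Kinv a Δ :=
  (Kinv_mono a h).antisymm fun φ hφ =>
    (hΓ a φ (hΔ.1 hφ)).2 fun hn => hΔ.neg_notMem hφ (h hn)

theorem canonRel_of_subset {Agent : Type} [Fintype Agent] {P : Sys}
    {S Γ Δ Θ : Set (Formula Agent)} (a : Agent) (hΓ : IsCanonWorld Agent P S Γ)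
    (hΔ : IsCanonWorld Agent P S Δ) (h : Γ ⊆ Δ) (hR : canonRel P a Δ Θ) :
    canonRel P a Γ Θ := by
  cases P with
  | ick => exact (Kinv_mono a h).trans hR
  | ickt => exact (Kinv_mono a h).trans hR
  | icks4 => exact (Set.image_mono (Kinv_mono a h)).trans hR
  | icks5 => exact (congrArg (Kimg a) ((hΓ.2 rfl).kinv_eq_of_subset hΔ.1 h a)).trans hR

theorem canonRel_refl {Agent : Type} [Fintype Agent] {P : Sys} (hT : P.hasT)
    {S Γ : Set (Formula Agent)} (hcl : Closed S) (a : Agent) (hΓ : IsCanonWorld Agent P S Γ) :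
    canonRel P a Γ Γ := by
  cases P with
  | ick => exact hT.elim
  | ickt => exact hΓ.1.kinv_subset hT hcl a
  | icks4 => exact Kimg_Kinv_subset a Γ
  | icks5 => exact rfl

theorem canonRel_trans {Agent : Type} {P : Sys} (h4 : P.hasS4) {a : Agent}
    {Γ Δ Θ : Set (Formula Agent)} (h₁ : canonRel P a Γ Δ) (h₂ : canonRel P a Δ Θ) :
    canonRel P a Γ Θ := by
  cases P with
  | ick => exact h4.elim
  | ickt => exact h4.elim
  | icks4 => exact Kimg_Kinv_subset_trans h₁ h₂
  | icks5 => exact Eq.trans h₁ h₂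

theorem canonRel_symm {Agent : Type} {P : Sys} (h5 : P.hasS5) {a : Agent}
    {Γ Δ : Set (Formula Agent)} (h : canonRel P a Γ Δ) : canonRel P a Δ Γ := by
  cases P with
  | icks5 => exact Eq.symm h
  | _ => exact h5.elim

theorem Sys.hasS4.hasT {P : Sys} (h : P.hasS4) : P.hasT := by
  cases P <;> trivial

theorem Sys.hasS5.hasS4 {P : Sys} (h : P.hasS5) : P.hasS4 := by
  cases P <;> trivial

theorem finite_canonWorld {Agent : Type} [Fintype Agent] (P : Sys) {S : Set (Formula Agent)}
    (hfin : S.Finite) : Finite (CanonWorld Agent P S) :=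
  (hfin.finite_subsets.subset fun _ hΓ => hΓ.1.1 :
    {Γ | IsCanonWorld Agent P S Γ}.Finite).to_subtype

/-- The canonical model `M^{(S, P)}`. -/
def canonModel (Agent : Type) [Fintype Agent] (P : Sys) (S : Set (Formula Agent)) :
    Model Agent (CanonWorld Agent P S) where
  le Γ Δ := Γ.1 ⊆ Δ.1
  R a Γ Δ := canonRel P a Γ.1 Δ.1
  V Γ n := Formula.atom n ∈ Γ.1
  le_refl _ := subset_rfl
  le_trans _ _ _ := Set.Subset.trans
  le_antisymm _ _ h₁ h₂ := Subtype.ext (h₁.antisymm h₂)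
  tri a Γ Δ _ h hR := canonRel_of_subset a Γ.2 Δ.2 h hR
  mono _ _ h _ hn := h hn

/-- The canonical model is a finite nonempty epistemic model of the appropriate class. -/
theorem canonical_model_is_model (Agent : Type) [Fintype Agent] [Nonempty Agent] (P : Sys)
    (S : Set (Formula Agent)) (hne : S.Nonempty) (hfin : S.Finite) (hcl : Closed S)
    (hneg : P = Sys.icks5 → NegClosed S) :
    Finite (CanonWorld Agent P S) ∧ Nonempty (CanonWorld Agent P S) ∧
    ∃ M : Model Agent (CanonWorld Agent P S),
      M.le = (fun Γ Δ => Γ.1 ⊆ Δ.1) ∧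
      M.R = (fun a Γ Δ => canonRel P a Γ.1 Δ.1) ∧
      M.V = (fun Γ n => Formula.atom n ∈ Γ.1) ∧
      (P.hasT → M.IsRefl) ∧ (P.hasS4 → M.IsS4) ∧ (P.hasS5 → M.IsS5) := by
  have hrefl : P.hasT → (canonModel Agent P S).IsRefl :=
    fun hT a Γ => canonRel_refl hT hcl a Γ.2
  have hS4 : P.hasS4 → (canonModel Agent P S).IsS4 :=
    fun h4 => ⟨hrefl h4.hasT, fun _ _ _ _ => canonRel_trans h4⟩
  exact ⟨finite_canonWorld P hfin, ⟨⟨_, isCanonWorld_holds P hcl hneg⟩⟩,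
    canonModel Agent P S, rfl, rfl, rfl, hrefl, hS4,
    fun h5 => ⟨hS4 h5.hasS4, fun _ _ _ => canonRel_symm h5⟩⟩

end ICK
end

section
/- Truth Lemma: let P ∈ {ICK, ICKT, ICKS4, ICKS5}, let Σ be a nonempty finite closed set of formulae (negation closed if P = ICKS5), and let M^{(Σ,P)} be the canonical model relative to Σ and P. Then for every world Γ of M^{(Σ,P)} and every formula φ ∈ Σ: φ ∈ Γ if and only if M^{(Σ,P)}, Γ ⊨ φ. -/
namespace ICK

section Propositional

variable {W : Type} (N : IModel W)

lemma ISat.mono (p : PropForm) {w v : W} (h : N.le w v) (hw : ISat N p w) : ISat N p v := by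
  induction p generalizing w v with
  | bot => exact hw
  | atom n => exact N.mono _ _ h n hw
  | and p q ihp ihq => exact ⟨ihp h hw.1, ihq h hw.2⟩
  | or p q ihp ihq => exact hw.imp (ihp h) (ihq h)
  | imp p q _ _ => exact fun u hu => hw u (N.le_trans _ _ _ h hu)

end Propositional

/-- The substitution sending the atoms `0`, `1`, `2` to the given formulae. -/
def substThree {Agent : Type} (φ ψ χ : Formula Agent) : ℕ → Formula Agent
  | 0 => φ
  | 1 => ψ
  | _ => χ

section Hilbert

variable {Agent : Type} [Fintype Agent] {P : Sys}

namespace Thm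

lemma imp_const (φ ψ : Formula Agent) : Thm Agent P (φ.imp (ψ.imp φ)) := by
  refine .ax (.taut P (.imp (.atom 0) (.imp (.atom 1) (.atom 0))) (substThree φ ψ ψ) ?_)
  intro W N w v _ hv u hu _
  exact ISat.mono N _ hu hv

lemma imp_distrib (φ ψ χ : Formula Agent) :
    Thm Agent P ((φ.imp (ψ.imp χ)).imp ((φ.imp ψ).imp (φ.imp χ))) := by
  refine .ax (.taut P (.imp (.imp (.atom 0) (.imp (.atom 1) (.atom 2)))
    (.imp (.imp (.atom 0) (.atom 1)) (.imp (.atom 0) (.atom 2)))) (substThree φ ψ χ) ?_)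
  intro W N w v _ hv u hu hu' t ht ht'
  exact hv t (N.le_trans _ _ _ hu ht) ht' t (N.le_refl t) (hu' t ht ht')

lemma and_intro (φ ψ : Formula Agent) : Thm Agent P (φ.imp (ψ.imp (φ.and ψ))) := by
  refine .ax (.taut P (.imp (.atom 0) (.imp (.atom 1) (.and (.atom 0) (.atom 1))))
    (substThree φ ψ ψ) ?_)
  intro W N w v _ hv u hu hu'
  exact ⟨ISat.mono N _ hu hv, hu'⟩

lemma and_left (φ ψ : Formula Agent) : Thm Agent P ((φ.and ψ).imp φ) :=
  .ax (.taut P (.imp (.and (.atom 0) (.atom 1)) (.atom 0)) (substThree φ ψ ψ)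
    fun _ _ _ _ _ hv => hv.1)

lemma and_right (φ ψ : Formula Agent) : Thm Agent P ((φ.and ψ).imp ψ) :=
  .ax (.taut P (.imp (.and (.atom 0) (.atom 1)) (.atom 1)) (substThree φ ψ ψ)
    fun _ _ _ _ _ hv => hv.2)

lemma or_inl (φ ψ : Formula Agent) : Thm Agent P (φ.imp (φ.or ψ)) :=
  .ax (.taut P (.imp (.atom 0) (.or (.atom 0) (.atom 1))) (substThree φ ψ ψ)
    fun _ _ _ _ _ hv => Or.inl hv)

lemma or_inr (φ ψ : Formula Agent) : Thm Agent P (ψ.imp (φ.or ψ)) :=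
  .ax (.taut P (.imp (.atom 1) (.or (.atom 0) (.atom 1))) (substThree φ ψ ψ)
    fun _ _ _ _ _ hv => Or.inr hv)

lemma or_elim (φ ψ χ : Formula Agent) :
    Thm Agent P ((φ.imp χ).imp ((ψ.imp χ).imp ((φ.or ψ).imp χ))) := by
  refine .ax (.taut P (.imp (.imp (.atom 0) (.atom 2)) (.imp (.imp (.atom 1) (.atom 2))
    (.imp (.or (.atom 0) (.atom 1)) (.atom 2)))) (substThree φ ψ χ) ?_)
  intro W N w v _ hv u hu hu' t ht ht'
  exact ht'.elim (hv t (N.le_trans _ _ _ hu ht)) (hu' t ht)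

lemma bot_elim (φ : Formula Agent) : Thm Agent P (Formula.bot.imp φ) :=
  .ax (.taut P (.imp .bot (.atom 0)) (substThree φ φ φ) fun _ _ _ _ _ hv => hv.elim)

lemma imp_self (φ : Formula Agent) : Thm Agent P (φ.imp φ) :=
  .ax (.taut P (.imp (.atom 0) (.atom 0)) (substThree φ φ φ) fun _ _ _ _ _ hv => hv)

lemma imp_trans {φ ψ χ : Formula Agent} (h₁ : Thm Agent P (φ.imp ψ))
    (h₂ : Thm Agent P (ψ.imp χ)) : Thm Agent P (φ.imp χ) :=
  .mp (.mp (imp_distrib φ ψ χ) (.mp (imp_const _ _) h₂)) h₁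

lemma imp_and {φ ψ χ : Formula Agent} (h₁ : Thm Agent P (φ.imp ψ))
    (h₂ : Thm Agent P (φ.imp χ)) : Thm Agent P (φ.imp (ψ.and χ)) :=
  .mp (.mp (imp_distrib φ χ _) (imp_trans h₁ (and_intro ψ χ))) h₂

lemma or_imp {φ ψ χ : Formula Agent} (h₁ : Thm Agent P (φ.imp χ))
    (h₂ : Thm Agent P (ψ.imp χ)) : Thm Agent P ((φ.or ψ).imp χ) :=
  .mp (.mp (or_elim φ ψ χ) h₁) h₂

lemma imp_Efml {φ χ : Formula Agent} (h : ∀ a, Thm Agent P (φ.imp (.know a χ))) :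
    Thm Agent P (φ.imp (Efml χ)) := by
  unfold Efml
  induction (Finset.univ : Finset Agent).toList with
  | nil => exact .mp (imp_const _ _) (imp_self _)
  | cons a l ih => exact imp_and (h a) ih

lemma Efml_imp (a : Agent) (φ : Formula Agent) :
    Thm Agent P ((Efml φ).imp (.know a φ)) := by
  unfold Efml
  have ha : a ∈ (Finset.univ : Finset Agent).toList := Finset.mem_toList.2 (Finset.mem_univ a)
  generalize (Finset.univ : Finset Agent).toList = l at ha
  induction l with
  | nil => exact (List.not_mem_nil ha).elim
  | cons b l ih =>
    rcases List.mem_cons.1 ha with rfl | ha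
    · exact and_left _ _
    · exact imp_trans (and_right _ _) (ih ha)

lemma ck_imp (φ : Formula Agent) : Thm Agent P (φ.ck.imp φ) :=
  imp_trans (.mp (and_left _ _) (.ax (.fix P φ))) (and_left _ _)

lemma ck_imp_know (a : Agent) (φ : Formula Agent) :
    Thm Agent P (φ.ck.imp (.know a φ.ck)) :=
  imp_trans (imp_trans (.mp (and_left _ _) (.ax (.fix P φ))) (and_right _ _)) (Efml_imp a _)

end Thm

variable {X Y : Set (Formula Agent)}

namespace Deriv

lemma trans (hXY : ∀ φ ∈ X, Deriv Agent P Y φ) {φ : Formula Agent} (h : Deriv Agent P X φ) :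
    Deriv Agent P Y φ := by
  induction h with
  | assum h => exact hXY _ h
  | thm h => exact .thm h
  | mp _ _ ih₁ ih₂ => exact .mp ih₁ ih₂

lemma mono (hXY : X ⊆ Y) {φ : Formula Agent} (h : Deriv Agent P X φ) : Deriv Agent P Y φ :=
  h.trans fun _ hφ => .assum (hXY hφ)

lemma app {φ ψ : Formula Agent} (h : Thm Agent P (φ.imp ψ)) (hφ : Deriv Agent P X φ) :
    Deriv Agent P X ψ :=
  .mp (.thm h) hφ

/-- The deduction theorem. -/
lemma deduction {φ ψ : Formula Agent} (h : Deriv Agent P (insert φ X) ψ) :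
    Deriv Agent P X (φ.imp ψ) := by
  induction h with
  | assum h =>
    rcases h with rfl | h
    · exact .thm (.imp_self _)
    · exact .app (.imp_const _ _) (.assum h)
  | thm h => exact .thm (.mp (.imp_const _ _) h)
  | mp _ _ ih₁ ih₂ => exact .mp (.app (.imp_distrib _ _ _) ih₁) ih₂

/-- Only finitely many assumptions are used, so derivability from the union of a chain
is derivability from one of its members. -/
lemma of_sUnion_chain {c : Set (Set (Formula Agent))} (hc : IsChain (· ⊆ ·) c)
    (hne : c.Nonempty) {φ : Formula Agent} (h : Deriv Agent P (⋃₀ c) φ) :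
    ∃ Y ∈ c, Deriv Agent P Y φ := by
  induction h with
  | assum h =>
    obtain ⟨Y, hY, hφ⟩ := h
    exact ⟨Y, hY, .assum hφ⟩
  | thm h =>
    obtain ⟨Y, hY⟩ := hne
    exact ⟨Y, hY, .thm h⟩
  | mp _ _ ih₁ ih₂ =>
    obtain ⟨Y, hY, h₁⟩ := ih₁
    obtain ⟨Z, hZ, h₂⟩ := ih₂
    rcases hc.total hY hZ with hYZ | hZY
    · exact ⟨Z, hZ, .mp (h₁.mono hYZ) h₂⟩
    · exact ⟨Y, hY, .mp h₁ (h₂.mono hZY)⟩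

/-- If `X ⊢ φ` and `Y` proves that every member of `X` is known, then `Y` proves that `φ`
is known. -/
lemma know {a : Agent} (hXY : ∀ φ ∈ X, Deriv Agent P Y (.know a φ)) {φ : Formula Agent}
    (h : Deriv Agent P X φ) : Deriv Agent P Y (.know a φ) := by
  induction h with
  | assum h => exact hXY _ h
  | thm h => exact .thm (.nec a h)
  | mp _ _ ih₁ ih₂ => exact .mp (.app (.ax (.axK P a _ _)) ih₁) ih₂

end Deriv

/-- Lindenbaum's lemma for prime theories in the full language. -/
lemma exists_primeTheory {χ : Formula Agent} (h : ¬ Deriv Agent P X χ) :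
    ∃ Θ, X ⊆ Θ ∧ PrimeTheory Agent P Set.univ Θ ∧ χ ∉ Θ := by
  obtain ⟨Θ, hXΘ, hmax⟩ := zorn_subset_nonempty {Y | ¬ Deriv Agent P Y χ}
    (fun c hcS hc hne => ⟨⋃₀ c, fun hd => by
      obtain ⟨Y, hY, hYd⟩ := hd.of_sUnion_chain hc hne
      exact hcS hY hYd, fun Y hY => Set.subset_sUnion_of_mem hY⟩) X h
  have hΘ : ¬ Deriv Agent P Θ χ := hmax.prop
  have himp : ∀ φ, φ ∉ Θ → Deriv Agent P Θ (φ.imp χ) := by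
    intro φ hφ
    by_contra hd
    refine hφ (hmax.le_of_ge (y := insert φ Θ) (fun h' => hd h'.deduction)
      (Set.subset_insert _ _) (Set.mem_insert _ _))
  refine ⟨Θ, hXΘ, ⟨Set.subset_univ _, fun hb => hΘ (.app (.bot_elim χ) hb), ?_, ?_⟩,
    fun h => hΘ (.assum h)⟩
  · intro φ hd _
    by_contra hφ
    exact hΘ (.mp (himp φ hφ) hd)
  · intro φ ψ hor
    by_contra! hn
    exact hΘ (.mp (.mp (.app (.or_elim _ _ _) (himp φ hn.1)) (himp ψ hn.2)) (.assum hor))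

/-- A finite set of formulae is interderivable with a single formula. -/
lemma exists_conj (hX : X.Finite) :
    ∃ γ, Deriv Agent P X γ ∧ ∀ φ ∈ X, Thm Agent P (γ.imp φ) := by
  induction X, hX using Set.Finite.induction_on with
  | empty => exact ⟨.top, .thm (.imp_self _), by simp⟩
  | @insert φ X _ _ ih =>
    obtain ⟨γ, hγ, hγX⟩ := ih
    refine ⟨φ.and γ, .mp (.app (.and_intro _ _) (.assum (Set.mem_insert _ _)))
      (hγ.mono (Set.subset_insert _ _)), ?_⟩
    rintro ψ (rfl | hψ)
    · exact .and_left _ _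
    · exact .imp_trans (.and_right _ _) (hγX ψ hψ)

/-- Every finite set of formulae has a join. -/
lemma exists_disj (hX : X.Finite) :
    ∃ χ, (∀ φ ∈ X, Thm Agent P (φ.imp χ)) ∧
      ∀ θ, (∀ φ ∈ X, Thm Agent P (φ.imp θ)) → Thm Agent P (χ.imp θ) := by
  induction X, hX using Set.Finite.induction_on with
  | empty => exact ⟨.bot, by simp, fun θ _ => .bot_elim θ⟩
  | @insert φ X _ _ ih =>
    obtain ⟨χ, hχ, hχX⟩ := ih
    refine ⟨φ.or χ, ?_, fun θ hθ => .or_imp (hθ φ (Set.mem_insert _ _))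
      (hχX θ fun ψ hψ => hθ ψ (Set.mem_insert_of_mem _ hψ))⟩
    rintro ψ (rfl | hψ)
    · exact .or_inl _ _
    · exact .imp_trans (hχ ψ hψ) (.or_inr _ _)

lemma Thm.imp_of_deriv {γ : Formula Agent} (hγ : ∀ φ ∈ X, Thm Agent P (γ.imp φ))
    {ψ : Formula Agent} (h : Deriv Agent P X ψ) : Thm Agent P (γ.imp ψ) := by
  induction h with
  | assum h => exact hγ _ h
  | thm h => exact .mp (.imp_const _ _) h
  | mp _ _ ih₁ ih₂ => exact .mp (.mp (.imp_distrib _ _ _) ih₁) ih₂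

end Hilbert

section Canonical

variable {Agent : Type} [Fintype Agent] {P : Sys} {S : Set (Formula Agent)}

/-- Restricting a prime theory of the full language to `S` yields a canonical world. -/
lemma PrimeTheory.isCanonWorld_inter {Θ : Set (Formula Agent)}
    (hΘ : PrimeTheory Agent P Set.univ Θ) (hcl : Closed S)
    (hneg : P = Sys.icks5 → NegClosed S) : IsCanonWorld Agent P S (Θ ∩ S) := by
  obtain ⟨-, hcons, hded, hprime⟩ := hΘ
  refine ⟨⟨Set.inter_subset_right, fun h => hcons (h.mono Set.inter_subset_left),
    fun φ h hφ => ⟨hded φ (h.mono Set.inter_subset_left) trivial, hφ⟩, ?_⟩, ?_⟩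
  · rintro φ ψ ⟨h, hS⟩
    obtain ⟨hφ, hψ⟩ := hcl.2.1 φ ψ hS
    exact (hprime φ ψ h).imp (⟨·, hφ⟩) (⟨·, hψ⟩)
  · rintro rfl a φ hφ
    have hem : Deriv Agent Sys.icks5 Θ ((Formula.know a φ).neg.or (.know a φ)) :=
      .thm (.mp (.ax (.axKc _ a φ _ trivial)) (.imp_self _))
    refine ⟨fun hk hn => hcons (.mp (.assum hn.1) (.assum hk.1)), fun hn => ?_⟩
    rcases hprime _ _ (hded _ hem trivial) with h | h
    · exact (hn ⟨h, (hneg rfl).2 a φ hφ⟩).elim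
    · exact ⟨h, hφ⟩

/-- A formula holding in all prime extensions of the canonical successors of `Γ` is
provably known at `Γ`. -/
lemma deriv_know_of_forall_succ {Γ : Set (Formula Agent)} (hΓ : IsCanonWorld Agent P S Γ)
    (a : Agent) (χ : Formula Agent)
    (h : ∀ Θ, PrimeTheory Agent P Set.univ Θ → canonRel P a Γ (Θ ∩ S) → χ ∈ Θ)
    (hcl : Closed S) : Deriv Agent P Γ (.know a χ) := by
  have key : ∀ X : Set (Formula Agent), (∀ φ ∈ X, Deriv Agent P Γ (.know a φ)) →
      (∀ Θ, PrimeTheory Agent P Set.univ Θ → X ⊆ Θ → canonRel P a Γ (Θ ∩ S)) →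
      Deriv Agent P Γ (.know a χ) := by
    intro X hX hR
    by_contra hn
    obtain ⟨Θ, hXΘ, hΘ, hχ⟩ := exists_primeTheory fun hd => hn (Deriv.know hX hd)
    exact hχ (h Θ hΘ (hR Θ hΘ hXΘ))
  have hS : Γ ⊆ S := hΓ.1.1
  cases P with
  | ick =>
    exact key (Kinv a Γ) (fun φ hφ => .assum hφ)
      fun Θ _ hX φ hφ => ⟨hX hφ, hcl.2.2.2.1 a φ (hS hφ)⟩
  | ickt =>
    exact key (Kinv a Γ) (fun φ hφ => .assum hφ)
      fun Θ _ hX φ hφ => ⟨hX hφ, hcl.2.2.2.1 a φ (hS hφ)⟩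
  | icks4 =>
    refine key (Kimg a (Kinv a Γ)) ?_ ?_
    · rintro _ ⟨φ, hφ, rfl⟩
      exact .app (.ax (.axS4 _ a φ trivial)) (.assum hφ)
    · rintro Θ _ hX _ ⟨φ, hφ, rfl⟩
      exact ⟨hX ⟨φ, hφ, rfl⟩, hS hφ⟩
  | icks5 =>
    refine key (Kimg a (Kinv a Γ) ∪ {ψ | ψ ∈ Γ ∧ ∃ φ, ψ = (Formula.know a φ).neg}) ?_ ?_
    · rintro _ (⟨φ, hφ, rfl⟩ | ⟨hψ, φ, rfl⟩)
      · exact .app (.ax (.axS4 _ a φ trivial)) (.assum hφ)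
      · exact .app (.ax (.axS5 _ a φ trivial)) (.assum hψ)
    · intro Θ hΘ hX
      suffices Kinv a Γ = Kinv a (Θ ∩ S) from congrArg (Kimg a) this
      ext φ
      refine ⟨fun hφ => ⟨hX (.inl ⟨φ, hφ, rfl⟩), hS hφ⟩, fun hφ => ?_⟩
      refine (hΓ.2 rfl a φ hφ.2).2 fun hn => hΘ.2.1 (.mp (.assum ?_) (.assum hφ.1))
      exact hX (.inr ⟨hn, φ, rfl⟩)

/-- The canonical relation transfers known formulae. -/
lemma mem_of_canonRel {Γ Δ : Set (Formula Agent)} {a : Agent} (hcl : Closed S)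
    (hΔ : PrimeTheory Agent P S Δ) (hR : canonRel P a Γ Δ) {φ : Formula Agent}
    (hφ : Formula.know a φ ∈ Γ) : φ ∈ Δ := by
  have hT : P.hasT → Formula.know a φ ∈ Δ → φ ∈ Δ := fun hP h =>
    hΔ.2.2.1 φ (.app (.ax (.axT P a φ hP)) (.assum h)) (hcl.2.2.2.1 a φ (hΔ.1 h))
  cases P with
  | ick => exact hR hφ
  | ickt => exact hR hφ
  | icks4 => exact hT trivial (hR ⟨φ, hφ, rfl⟩)
  | icks5 =>
    have h : Formula.know a φ ∈ Kimg a (Kinv a Δ) :=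
      (show Kimg a (Kinv a Γ) = Kimg a (Kinv a Δ) from hR) ▸ ⟨φ, hφ, rfl⟩
    obtain ⟨ψ, hψ, he⟩ := h
    exact hT trivial (he ▸ hψ)

lemma CanonWorld.finite (hfin : S.Finite) : Finite (CanonWorld Agent P S) :=
  (hfin.finite_subsets.subset fun _ hΓ => hΓ.1.1).to_subtype

/-- If a set `B` of canonical worlds is closed under accessibility and all its members
contain `φ`, then `Cφ` is derivable from each of its members. -/
lemma deriv_ck_of_closed (hfin : S.Finite) (hcl : Closed S)
    (hneg : P = Sys.icks5 → NegClosed S) {φ : Formula Agent} {B : Set (CanonWorld Agent P S)}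
    (hB : ∀ Γ ∈ B, ∀ (a : Agent) (Δ : CanonWorld Agent P S), canonRel P a Γ.1 Δ.1 → Δ ∈ B)
    (hφ : ∀ Γ ∈ B, φ ∈ Γ.1) {Γ : CanonWorld Agent P S} (hΓ : Γ ∈ B) :
    Deriv Agent P Γ.1 φ.ck := by
  have := CanonWorld.finite (P := P) hfin
  choose γ hγ hγ' using fun Δ : CanonWorld Agent P S =>
    exists_conj (P := P) (hfin.subset Δ.2.1.1)
  obtain ⟨χ, hχ, hχ'⟩ := exists_disj (P := P) (B.toFinite.image γ)
  have hstep : Thm Agent P (χ.imp (Efml χ)) := by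
    refine .imp_Efml fun a => hχ' _ ?_
    rintro _ ⟨Δ, hΔ, rfl⟩
    refine .imp_of_deriv (hγ' Δ) (deriv_know_of_forall_succ Δ.2 a χ (fun Θ hΘ hR => ?_) hcl)
    let Δ' : CanonWorld Agent P S := ⟨Θ ∩ S, hΘ.isCanonWorld_inter hcl hneg⟩
    exact hΘ.2.2.1 χ (.app (hχ _ ⟨Δ', hB Δ hΔ a Δ' hR, rfl⟩)
      ((hγ Δ').mono Set.inter_subset_left)) trivial
  have hχφ : Thm Agent P (χ.imp φ) := by
    refine hχ' φ ?_
    rintro _ ⟨Δ, hΔ, rfl⟩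
    exact hγ' Δ φ (hφ Δ hΔ)
  exact .app (.imp_trans (.ind hstep) (.mon hχφ)) (.app (hχ _ ⟨Γ, hΓ, rfl⟩) (hγ Γ))

end Canonical

/-- Truth Lemma for the canonical model. -/
theorem truth_lemma (Agent : Type) [Fintype Agent] [Nonempty Agent] (P : Sys)
    (S : Set (Formula Agent)) (hne : S.Nonempty) (hfin : S.Finite) (hcl : Closed S)
    (hneg : P = Sys.icks5 → NegClosed S)
    (M : Model Agent (CanonWorld Agent P S))
    (hle : M.le = fun Γ Δ => Γ.1 ⊆ Δ.1)
    (hR : M.R = fun a Γ Δ => canonRel P a Γ.1 Δ.1)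
    (hV : M.V = fun Γ n => Formula.atom n ∈ Γ.1)
    (Γ : CanonWorld Agent P S) (φ : Formula Agent) (hφ : φ ∈ S) :
    φ ∈ Γ.1 ↔ Sat M φ Γ := by
  have hRiff : ∀ a Γ Δ, M.R a Γ Δ ↔ canonRel P a Γ.1 Δ.1 := by simp [hR]
  have hleiff : ∀ Γ Δ, M.le Γ Δ ↔ Γ.1 ⊆ Δ.1 := by simp [hle]
  induction φ generalizing Γ with
  | bot => exact iff_of_false (fun h => Γ.2.1.2.1 (.assum h)) id
  | atom n => simp [Sat, hV]
  | and φ ψ ihφ ihψ =>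
    obtain ⟨hφS, hψS⟩ := hcl.1 φ ψ hφ
    have hded := Γ.2.1.2.2.1
    refine Iff.trans ?_ (and_congr (ihφ Γ hφS) (ihψ Γ hψS))
    exact ⟨fun h => ⟨hded _ (.app (.and_left _ _) (.assum h)) hφS,
      hded _ (.app (.and_right _ _) (.assum h)) hψS⟩,
      fun h => hded _ (.mp (.app (.and_intro _ _) (.assum h.1)) (.assum h.2)) hφ⟩
  | or φ ψ ihφ ihψ =>
    obtain ⟨hφS, hψS⟩ := hcl.2.1 φ ψ hφ
    have hded := Γ.2.1.2.2.1
    refine Iff.trans ?_ (or_congr (ihφ Γ hφS) (ihψ Γ hψS))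
    exact ⟨Γ.2.1.2.2.2 φ ψ, fun h => h.elim
      (fun h => hded _ (.app (.or_inl _ _) (.assum h)) hφ)
      (fun h => hded _ (.app (.or_inr _ _) (.assum h)) hφ)⟩
  | imp φ ψ ihφ ihψ =>
    obtain ⟨hφS, hψS⟩ := hcl.2.2.1 φ ψ hφ
    refine ⟨fun h Δ hΔ hs => ?_, fun h => ?_⟩
    · refine (ihψ Δ hψS).1 (Δ.2.1.2.2.1 ψ ?_ hψS)
      exact .mp (.assum ((hleiff _ _).1 hΔ h)) (.assum ((ihφ Δ hφS).2 hs))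
    · by_contra hn
      obtain ⟨Θ, hΓΘ, hΘ, hψΘ⟩ := exists_primeTheory (X := insert φ Γ.1) (χ := ψ)
        fun hd => hn (Γ.2.1.2.2.1 _ hd.deduction hφ)
      let Δ : CanonWorld Agent P S := ⟨Θ ∩ S, hΘ.isCanonWorld_inter hcl hneg⟩
      have hΔ : M.le Γ Δ := (hleiff _ _).2 fun θ hθ => ⟨hΓΘ (.inr hθ), Γ.2.1.1 hθ⟩
      exact hψΘ ((ihψ Δ hψS).2 (h Δ hΔ ((ihφ Δ hφS).1 ⟨hΓΘ (.inl rfl), hφS⟩))).1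
  | know a φ ih =>
    have hφS := hcl.2.2.2.1 a φ hφ
    refine ⟨fun h Δ hΔ => ?_, fun h => ?_⟩
    · exact (ih Δ hφS).1 (mem_of_canonRel hcl Δ.2.1 ((hRiff _ _ _).1 hΔ) h)
    · refine Γ.2.1.2.2.1 _ (deriv_know_of_forall_succ Γ.2 a φ (fun Θ hΘ hrel => ?_) hcl) hφ
      let Δ : CanonWorld Agent P S := ⟨Θ ∩ S, hΘ.isCanonWorld_inter hcl hneg⟩
      exact ((ih Δ hφS).2 (h Δ ((hRiff _ _ _).2 hrel))).1
  | ck φ ih =>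
    obtain ⟨hφS, hkS⟩ := hcl.2.2.2.2 φ hφ
    refine ⟨fun h Δ hΔ => ?_, fun h => ?_⟩
    · have hck : φ.ck ∈ Δ.1 := by
        induction hΔ with
        | refl => exact h
        | @tail Δ Δ' _ hs hmem =>
          obtain ⟨a, ha⟩ := hs
          exact mem_of_canonRel hcl Δ'.2.1 ((hRiff _ _ _).1 ha)
            (Δ.2.1.2.2.1 _ (.app (.ck_imp_know a φ) (.assum hmem)) (hkS a))
      exact (ih Δ hφS).1 (Δ.2.1.2.2.1 φ (.app (.ck_imp φ) (.assum hck)) hφS)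
    · refine Γ.2.1.2.2.1 _ (deriv_ck_of_closed (B := {Δ | Sat M φ.ck Δ}) hfin hcl hneg
        (fun Δ hΔ a Δ' hrel Θ hΘ => ?_) (fun Δ hΔ => ?_) h) hφ
      · exact hΔ Θ (.head ⟨a, (hRiff _ _ _).2 hrel⟩ hΘ)
      · exact (ih Δ hφS).2 (hΔ Δ .refl)

end ICK
end
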